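/- arXiv:2505.08026 — 3 statements merged into one kernel-verified Lean document; each statement's English description precedes it below -/
import Mathlib

section
/- Assume the confidence bounds are valid. Then for every n ≥ 0 and every a ∈ S_n, ‖g_i(a)‖ ≥ c_i for all i ∈ I_g; that is, every parameter contained in any safe set S_n is safe. -/
open Finset Real Set

/-- **Safety.** Assume the confidence bounds are valid. Then for every
`n ≥ 0` and every `a ∈ S_n`, `‖g_i(a)‖ ≥ c_i` for all `i ∈ I_g`. -/
theorem colsafe_safe_sets_are_safe
    (d q : ℕ)
    (A : Finset (EuclideanSpace ℝ (Fin d)))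
    -- the reward function f and the constraint functions g_i with thresholds c_i
    (f : EuclideanSpace ℝ (Fin d) → ℝ)
    (mi : Fin q → ℕ)
    (g : (i : Fin q) → EuclideanSpace ℝ (Fin d) → EuclideanSpace ℝ (Fin (mi i)))
    (c : Fin q → ℝ)
    (L : ℝ) (hL : 0 ≤ L)
    (hgLip : ∀ i : Fin q, ∀ x ∈ A, ∀ y ∈ A, ‖g i x - g i y‖ ≤ L * ‖x - y‖)
    -- the safe seed
    (S0 : Set (EuclideanSpace ℝ (Fin d))) (hS0A : S0 ⊆ ↑A) (hS0ne : S0.Nonempty)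
    (hS0safe : ∀ a ∈ S0, ∀ i : Fin q, c i ≤ ‖g i a‖)
    -- lower/upper confidence bounds (index 0 = reward, index i.succ = constraint i)
    (l u : ℕ → EuclideanSpace ℝ (Fin d) → Fin (q + 1) → ℝ)
    (hlu : ∀ n, 1 ≤ n → ∀ a i, l n a i ≤ u n a i)
    (hlmono : ∀ n, 1 ≤ n → ∀ a i, l n a i ≤ l (n + 1) a i)
    (humono : ∀ n, 1 ≤ n → ∀ a i, u (n + 1) a i ≤ u n a i)
    (hlseed : ∀ n, 1 ≤ n → ∀ a ∈ S0, ∀ i : Fin q, c i ≤ l n a i.succ)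
    -- validity of the confidence bounds
    (hvalid : ∀ n, 1 ≤ n → ∀ a ∈ A,
      l n a 0 ≤ f a ∧ f a ≤ u n a 0 ∧
      ∀ i : Fin q, l n a i.succ ≤ ‖g i a‖ ∧ ‖g i a‖ ≤ u n a i.succ)
    -- the safe sets
    (S : ℕ → Set (EuclideanSpace ℝ (Fin d)))
    (hS0def : S 0 = S0)
    (hSrec : ∀ n : ℕ, S (n + 1) =
      ⋂ i : Fin q, ⋃ a ∈ S n,
        {a' : EuclideanSpace ℝ (Fin d) | a' ∈ A ∧ c i ≤ l (n + 1) a i.succ - L * ‖a - a'‖}) :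
    ∀ n : ℕ, ∀ a ∈ S n, ∀ i : Fin q, c i ≤ ‖g i a‖ := by
  intro n a ha i
  have mem_of_succ : ∀ k, ∀ x ∈ S (k + 1), ∃ y ∈ S k,
      x ∈ A ∧ c i ≤ l (k + 1) y i.succ - L * ‖y - x‖ := by
    intro k x hx
    rw [hSrec k] at hx
    simpa only [Set.mem_iUnion, exists_prop, Set.mem_ofPred_eq] using Set.mem_iInter.1 hx i
  have subset_A : ∀ k, ∀ x ∈ S k, x ∈ A := by
    intro k x hx
    cases k with
    | zero => exact hS0A (hS0def ▸ hx)
    | succ k =>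
      obtain ⟨_, _, hxA, _⟩ := mem_of_succ k x hx
      exact hxA
  cases n with
  | zero => exact hS0safe a (hS0def ▸ ha) i
  | succ n =>
    obtain ⟨y, hy, haA, hc⟩ := mem_of_succ n a ha
    have hyA := subset_A n y hy
    have hl := ((hvalid (n + 1) (Nat.le_add_left 1 n) y hyA).2.2 i).1
    have hLip := hgLip i y hyA a haA
    have htri := norm_sub_norm_le (g i y) (g i a)
    linarith
end

section
/- Let 1 ≤ n₀ ≤ n₁ and suppose S_{n₁} = S_{n₀}. Then for every n with n₀ ≤ n < n₁: G_{n+1} ∪ M_{n+1} ⊆ G_n ∪ M_n. -/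
open Finset Real Set

/-- Let `1 ≤ n₀ ≤ n₁` and suppose `S_{n₁} = S_{n₀}`. Then for every `n`
with `n₀ ≤ n < n₁`: `G_{n+1} ∪ M_{n+1} ⊆ G_n ∪ M_n`. -/
theorem colsafe_expanders_maximizers_decreasing
    (d q : ℕ)
    (A : Finset (EuclideanSpace ℝ (Fin d)))
    -- the reward function f and the constraint functions g_i with thresholds c_i
    (f : EuclideanSpace ℝ (Fin d) → ℝ)
    (mi : Fin q → ℕ)
    (g : (i : Fin q) → EuclideanSpace ℝ (Fin d) → EuclideanSpace ℝ (Fin (mi i)))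
    (c : Fin q → ℝ)
    (L : ℝ) (hL : 0 ≤ L)
    (hgLip : ∀ i : Fin q, ∀ x ∈ A, ∀ y ∈ A, ‖g i x - g i y‖ ≤ L * ‖x - y‖)
    -- the safe seed
    (S0 : Set (EuclideanSpace ℝ (Fin d))) (hS0A : S0 ⊆ ↑A) (hS0ne : S0.Nonempty)
    (hS0safe : ∀ a ∈ S0, ∀ i : Fin q, c i ≤ ‖g i a‖)
    -- lower/upper confidence bounds (index 0 = reward, index i.succ = constraint i)
    (l u : ℕ → EuclideanSpace ℝ (Fin d) → Fin (q + 1) → ℝ)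
    (hlu : ∀ n, 1 ≤ n → ∀ a i, l n a i ≤ u n a i)
    (hlmono : ∀ n, 1 ≤ n → ∀ a i, l n a i ≤ l (n + 1) a i)
    (humono : ∀ n, 1 ≤ n → ∀ a i, u (n + 1) a i ≤ u n a i)
    (hlseed : ∀ n, 1 ≤ n → ∀ a ∈ S0, ∀ i : Fin q, c i ≤ l n a i.succ)
    -- the safe sets
    (S : ℕ → Set (EuclideanSpace ℝ (Fin d)))
    (hS0def : S 0 = S0)
    (hSrec : ∀ n : ℕ, S (n + 1) =
      ⋂ i : Fin q, ⋃ a ∈ S n,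
        {a' : EuclideanSpace ℝ (Fin d) | a' ∈ A ∧ c i ≤ l (n + 1) a i.succ - L * ‖a - a'‖})
    -- the potential maximizers M_n and the potential expanders G_n
    (M G : ℕ → Set (EuclideanSpace ℝ (Fin d)))
    (hM : ∀ n a, a ∈ M n ↔ a ∈ S n ∧ ∀ a' ∈ S n, l n a' 0 ≤ u n a 0)
    (hG : ∀ n a, a ∈ G n ↔ a ∈ S n ∧
      ∃ a' ∈ (↑A : Set (EuclideanSpace ℝ (Fin d))) \ S n,
        ∃ i : Fin q, c i ≤ u n a i.succ - L * ‖a - a'‖)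
    -- the iterations n₀ ≤ n₁ with identical safe sets
    (n₀ n₁ : ℕ) (hn₀ : 1 ≤ n₀) (hn₀₁ : n₀ ≤ n₁) (hSeq : S n₁ = S n₀) :
    ∀ n : ℕ, n₀ ≤ n → n < n₁ → G (n + 1) ∪ M (n + 1) ⊆ G n ∪ M n := by
  have hstep : ∀ n, S n ⊆ S (n + 1) := by
    intro n
    induction n with
    | zero =>
      intro a ha
      rw [hS0def] at ha
      rw [hSrec 0, hS0def]
      simp only [Set.mem_iInter, Set.mem_iUnion, Set.mem_ofPred_eq]
      intro i
      exact ⟨a, ha, hS0A ha, by simpa using hlseed 1 le_rfl a ha i⟩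
    | succ k ih =>
      intro a' ha'
      rw [hSrec k] at ha'
      rw [hSrec (k + 1)]
      simp only [Set.mem_iInter, Set.mem_iUnion, Set.mem_ofPred_eq] at ha' ⊢
      intro i
      obtain ⟨a, ha, hA, hc⟩ := ha' i
      exact ⟨a, ih ha, hA, by linarith [hlmono (k + 1) (by omega) a i.succ]⟩
  have hmono : Monotone S := monotone_nat_of_le_succ hstep
  intro n hn hn'
  have hS : S (n + 1) = S n :=
    Set.Subset.antisymm
      ((hmono (show n + 1 ≤ n₁ by omega)).trans (hSeq.subset.trans (hmono hn))) (hstep n)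
  have hn1 : 1 ≤ n := hn₀.trans hn
  apply Set.union_subset_union
  · intro a ha
    rw [hG, hS] at ha
    obtain ⟨haS, a', ha', i, hc⟩ := ha
    exact (hG n a).2 ⟨haS, a', ha', i, by linarith [humono n hn1 a i.succ]⟩
  · intro a ha
    rw [hM, hS] at ha
    exact (hM n a).2 ⟨ha.1, fun a' ha' =>
      (hlmono n hn1 a' 0).trans ((ha.2 a' ha').trans (humono n hn1 a 0))⟩
end

section
/- Assume the confidence bounds are valid. If for some n ≥ 1 the safe set satisfies S_{n−1} = S_n and w_n(a,i) ≤ 2β̄ for all a ∈ M_n ∪ G_n and all i ∈ I, then R̄_β̄(S_0) ⊆ S_n. -/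
open Finset Real Set

/-- Assume the confidence bounds are valid. If for some `n ≥ 1` the safe
set satisfies `S_{n−1} = S_n` and `w_n(a,i) ≤ 2β̄` for all `a ∈ M_n ∪ G_n` and all `i ∈ I`,
then `R̄_β̄(S_0) ⊆ S_n`. -/
theorem colsafe_full_exploration
    (d q : ℕ)
    (A : Finset (EuclideanSpace ℝ (Fin d)))
    -- the reward function f and the constraint functions g_i with thresholds c_i
    (f : EuclideanSpace ℝ (Fin d) → ℝ)
    (mi : Fin q → ℕ)
    (g : (i : Fin q) → EuclideanSpace ℝ (Fin d) → EuclideanSpace ℝ (Fin (mi i)))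
    (c : Fin q → ℝ)
    (L beta : ℝ) (hL : 0 ≤ L) (hbeta : 0 < beta)
    (hgLip : ∀ i : Fin q, ∀ x ∈ A, ∀ y ∈ A, ‖g i x - g i y‖ ≤ L * ‖x - y‖)
    -- the safe seed
    (S0 : Set (EuclideanSpace ℝ (Fin d))) (hS0A : S0 ⊆ ↑A) (hS0ne : S0.Nonempty)
    (hS0safe : ∀ a ∈ S0, ∀ i : Fin q, c i ≤ ‖g i a‖)
    -- lower/upper confidence bounds (index 0 = reward, index i.succ = constraint i)
    (l u : ℕ → EuclideanSpace ℝ (Fin d) → Fin (q + 1) → ℝ)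
    (hlu : ∀ n, 1 ≤ n → ∀ a i, l n a i ≤ u n a i)
    (hlmono : ∀ n, 1 ≤ n → ∀ a i, l n a i ≤ l (n + 1) a i)
    (humono : ∀ n, 1 ≤ n → ∀ a i, u (n + 1) a i ≤ u n a i)
    (hlseed : ∀ n, 1 ≤ n → ∀ a ∈ S0, ∀ i : Fin q, c i ≤ l n a i.succ)
    -- validity of the confidence bounds
    (hvalid : ∀ n, 1 ≤ n → ∀ a ∈ A,
      l n a 0 ≤ f a ∧ f a ≤ u n a 0 ∧
      ∀ i : Fin q, l n a i.succ ≤ ‖g i a‖ ∧ ‖g i a‖ ≤ u n a i.succ)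
    -- the safe sets
    (S : ℕ → Set (EuclideanSpace ℝ (Fin d)))
    (hS0def : S 0 = S0)
    (hSrec : ∀ n : ℕ, S (n + 1) =
      ⋂ i : Fin q, ⋃ a ∈ S n,
        {a' : EuclideanSpace ℝ (Fin d) | a' ∈ A ∧ c i ≤ l (n + 1) a i.succ - L * ‖a - a'‖})
    -- the potential maximizers M_n and the potential expanders G_n
    (M G : ℕ → Set (EuclideanSpace ℝ (Fin d)))
    (hM : ∀ n a, a ∈ M n ↔ a ∈ S n ∧ ∀ a' ∈ S n, l n a' 0 ≤ u n a 0)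
    (hG : ∀ n a, a ∈ G n ↔ a ∈ S n ∧
      ∃ a' ∈ (↑A : Set (EuclideanSpace ℝ (Fin d))) \ S n,
        ∃ i : Fin q, c i ≤ u n a i.succ - L * ‖a - a'‖)
    -- the reachability operator R_β̄
    (R : Set (EuclideanSpace ℝ (Fin d)) → Set (EuclideanSpace ℝ (Fin d)))
    (hR : ∀ T : Set (EuclideanSpace ℝ (Fin d)), R T =
      T ∪ ⋂ i : Fin q,
        {a : EuclideanSpace ℝ (Fin d) | a ∈ A ∧
          ∃ a' ∈ T, c i ≤ ‖g i a'‖ - 2 * beta - L * ‖a - a'‖})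
    -- the stopping condition at iteration n
    (n : ℕ) (hn : 1 ≤ n) (hSstop : S (n - 1) = S n)
    (hwstop : ∀ a ∈ M n ∪ G n, ∀ i : Fin (q + 1), u n a i - l n a i ≤ 2 * beta) :
    (⋃ k : ℕ, R^[k + 1] S0) ⊆ S n := by
  obtain ⟨m, rfl⟩ : ∃ m, n = m + 1 := ⟨n - 1, by omega⟩
  rw [Nat.add_sub_cancel] at hSstop
  have mem_succ : ∀ k x, x ∈ S (k + 1) ↔ ∀ i : Fin q, ∃ a ∈ S k,
      x ∈ A ∧ c i ≤ l (k + 1) a i.succ - L * ‖a - x‖ := by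
    intro k x
    rw [hSrec k]
    simp only [Set.mem_iInter, Set.mem_iUnion, Set.mem_ofPred_eq, exists_prop]
  have seed_subset : ∀ k, S0 ⊆ S k := by
    intro k
    induction k with
    | zero => exact hS0def.ge
    | succ k ih =>
      intro x hx
      refine (mem_succ k x).2 fun i => ⟨x, ih hx, hS0A hx, ?_⟩
      simpa using hlseed (k + 1) (Nat.succ_pos k) x hx i
  have reach_subset : ∀ T, T ⊆ S (m + 1) → R T ⊆ S (m + 1) := by
    intro T hT x hx
    rw [hR] at hx
    rcases hx with hx | hx
    · exact hT hx
    by_contra hxS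
    refine hxS ((mem_succ m x).2 fun i => ?_)
    obtain ⟨hxA, a, haT, ha⟩ := Set.mem_iInter.1 hx i
    have haS := hT haT
    obtain ⟨_, _, haA, _⟩ := (mem_succ m a).1 haS i
    have hgu := ((hvalid (m + 1) hn a haA).2.2 i).2
    rw [norm_sub_rev] at ha
    have haG : a ∈ G (m + 1) := (hG _ a).2 ⟨haS, x, ⟨hxA, hxS⟩, i, by linarith⟩
    have hw := hwstop a (Or.inr haG) i.succ
    exact ⟨a, hSstop.ge haS, hxA, by linarith⟩
  have iterate_subset : ∀ k, R^[k] S0 ⊆ S (m + 1) := by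
    intro k
    induction k with
    | zero => exact seed_subset (m + 1)
    | succ k ih =>
      rw [Function.iterate_succ_apply']
      exact reach_subset _ ih
  exact Set.iUnion_subset fun k => iterate_subset (k + 1)
end
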